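/- arXiv:math/9910131 — 9 statements merged into one kernel-verified Lean document; each statement's English description precedes it below -/
import Mathlib

section
/- Let R be a unital ring and let u be a quasi-invertible element of R. Then u is von Neumann regular, and one can choose an element v in R such that u v u = u, v u v = v, and the idempotents 1 - u v and 1 - v u are centrally orthogonal; in particular v is itself quasi-invertible. -/
/-- `x` and `y` are centrally orthogonal: `x r y = 0` and `y r x = 0` for all `r`. -/
def CentOrth {R : Type*} [Ring R] (x y : R) : Prop :=
  ∀ r : R, x * r * y = 0 ∧ y * r * x = 0

/-- `u` is quasi-invertible: `(1 - u a) ⊥ (1 - b u)` for some `a, b`. -/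
def QuasiInv {R : Type*} [Ring R] (u : R) : Prop :=
  ∃ a b : R, CentOrth (1 - u * a) (1 - b * u)

theorem CentOrth.symm {R : Type*} [Ring R] {x y : R} (h : CentOrth x y) : CentOrth y x :=
  fun r => (h r).symm

/-- Multiplying on either side preserves central orthogonality. -/
theorem CentOrth.mul_right_mul_left {R : Type*} [Ring R] {x y : R} (h : CentOrth x y) (s t : R) :
    CentOrth (x * s) (t * y) := by
  intro r
  constructor
  · calc x * s * r * (t * y) = x * (s * r * t) * y := by noncomm_ring
      _ = 0 := (h _).1
  · calc t * y * r * (x * s) = t * (y * r * x) * s := by noncomm_ring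
      _ = 0 := by rw [(h r).2, mul_zero, zero_mul]

/-- Every quasi-invertible element `u` is von Neumann regular, and admits a quasi-inverse `v`
with `u v u = u`, `v u v = v`, `(1 - u v) ⊥ (1 - v u)`; in particular `v` is quasi-invertible. -/
theorem quasiInv_vonNeumannRegular_and_exists_quasiInverse
    {R : Type*} [Ring R] (u : R) (hu : QuasiInv u) :
    (∃ x : R, u = u * x * u) ∧
    ∃ v : R, u * v * u = u ∧ v * u * v = v ∧
      CentOrth (1 - u * v) (1 - v * u) ∧ QuasiInv v := by
  obtain ⟨a, b, h⟩ := hu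
  set w := a + b - a * u * b with hw
  have huw : u * w * u = u := by
    have h0 : u - u * w * u = (1 - u * a) * u * (1 - b * u) := by rw [hw]; noncomm_ring
    rw [(h u).1] at h0
    exact (sub_eq_zero.mp h0).symm
  have hleft : 1 - u * w = (1 - u * a) * (1 - u * b) := by rw [hw]; noncomm_ring
  have hright : 1 - w * u = (1 - a * u) * (1 - b * u) := by rw [hw]; noncomm_ring
  have horth : CentOrth (1 - u * w) (1 - w * u) := by
    rw [hleft, hright]
    exact h.mul_right_mul_left _ _
  have huv : u * (w * u * w) = u * w := by rw [← mul_assoc, ← mul_assoc, huw]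
  have hvu : w * u * w * u = w * u := by rw [mul_assoc w u w, mul_assoc w, huw]
  refine ⟨⟨w, huw.symm⟩, w * u * w, ?_, ?_, ?_, u, u, ?_⟩
  · rw [huv, huw]
  · rw [hvu, ← mul_assoc, ← mul_assoc, hvu]
  · rw [huv, hvu]
    exact horth
  · rw [huv, hvu]
    exact horth.symm
end

section
/- Let R be a ring and let R^r denote the set of von Neumann regular elements of R. The relation ≤ on R^r, defined by a ≤ b if and only if there exists x in R with a = a x b = b x a = a x a, is a partial order on R^r: it is reflexive, transitive, and antisymmetric. -/
/-- `a` is von Neumann regular. -/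
def VNRegular {R : Type*} [Ring R] (a : R) : Prop :=
  ∃ x : R, a = a * x * a

/-- The extension order on von Neumann regular elements:
`a ≤ b` iff `a = a x b = b x a = a x a` for some `x`. -/
def RegLe {R : Type*} [Ring R] (a b : R) : Prop :=
  ∃ x : R, a = a * x * b ∧ a = b * x * a ∧ a = a * x * a

/-- Proposition 2.5: the relation `≤` is a partial order on the set of
von Neumann regular elements. -/
theorem regLe_partialOrder {R : Type*} [Ring R] :
    (∀ a : R, VNRegular a → RegLe a a) ∧
    (∀ a b c : R, VNRegular a → VNRegular b → VNRegular c →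
      RegLe a b → RegLe b c → RegLe a c) ∧
    (∀ a b : R, VNRegular a → VNRegular b → RegLe a b → RegLe b a → a = b) := by
  refine ⟨fun a ⟨x, hx⟩ => ⟨x, hx, hx, hx⟩, ?_, ?_⟩
  · rintro a b c - - - ⟨x, hab, hba, haa⟩ ⟨y, hbc, hcb, hbb⟩
    have hl : a * y * b = a := by
      calc a * y * b = a * x * b * y * b := by rw [← hab]
        _ = a * x * (b * y * b) := by noncomm_ring
        _ = a := by rw [← hbb, ← hab]
    have hr : b * y * a = a := by
      calc b * y * a = b * y * (b * x * a) := by rw [← hba]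
        _ = b * y * b * x * a := by noncomm_ring
        _ = a := by rw [← hbb, ← hba]
    refine ⟨y * b * x * b * y, ?_, ?_, ?_⟩
    · calc a = a * x * b := hab
        _ = a * y * b * x * (b * y * c) := by rw [hl, ← hbc]
        _ = a * (y * b * x * b * y) * c := by noncomm_ring
    · calc a = b * x * a := hba
        _ = c * y * b * x * (b * y * a) := by rw [hr, ← hcb]
        _ = c * (y * b * x * b * y) * a := by noncomm_ring
    · calc a = a * x * a := haa
        _ = a * y * b * x * (b * y * a) := by rw [hl, hr]
        _ = a * (y * b * x * b * y) * a := by noncomm_ring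
  · rintro a b - - ⟨x, hab, -, haa⟩ ⟨y, -, hba, -⟩
    calc a = a * x * b := hab
      _ = a * x * (a * y * b) := by rw [← hba]
      _ = a * x * a * y * b := by noncomm_ring
      _ = b := by rw [← haa, ← hba]
end

section
/- Let R be a unital ring. Every quasi-invertible element u of R is maximal among the von Neumann regular elements of R with respect to the order ≤: if a is von Neumann regular and u ≤ a, then a = u. -/
/-- Proposition 2.8: every quasi-invertible element is maximal among the
von Neumann regular elements with respect to `≤`. -/
theorem quasiInv_maximal_regular {R : Type*} [Ring R] (u : R) (hu : QuasiInv u) :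
    ∀ a : R, VNRegular a → RegLe u a → a = u := by
  rintro a - ⟨x, hxa, hax, hx⟩
  obtain ⟨c, b, h⟩ := hu
  have hl : (1 - u * x) * (1 - u * c) = 1 - u * x := by
    have h0 : (1 - u * x) * u = 0 := by rw [sub_mul, one_mul, ← hx, sub_self]
    rw [mul_sub, mul_one, ← mul_assoc, h0, zero_mul, sub_zero]
  have hr : (1 - b * u) * (1 - x * u) = 1 - x * u := by
    have h0 : u * (1 - x * u) = 0 := by rw [mul_sub, mul_one, ← mul_assoc, ← hx, sub_self]
    rw [sub_mul, one_mul, mul_assoc, h0, mul_zero, sub_zero]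
  have hdl : (1 - u * x) * (a - u) = a - u := by
    rw [sub_mul, one_mul, mul_sub (u * x), ← hxa, ← hx, sub_self, sub_zero]
  have hdr : (a - u) * (1 - x * u) = a - u := by
    rw [mul_sub, mul_one, ← mul_assoc, sub_mul, sub_mul, ← hax, ← hx, sub_self, sub_zero]
  apply sub_eq_zero.mp
  calc
    a - u = (1 - u * x) * (a - u) * (1 - x * u) := by rw [hdl, hdr]
    _ = (1 - u * x) * ((1 - u * c) * (a - u) * (1 - b * u)) * (1 - x * u) := by
      conv_lhs => rw [← hl, ← hr]
      simp only [mul_assoc]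
    _ = 0 := by rw [(h (a - u)).1, mul_zero, zero_mul]
end

section
/- Let R be a unital ring and let a be a von Neumann regular element of R. Then the following are equivalent: (i) there exists a quasi-invertible element u of R with a ≤ u; (ii) there exists a quasi-invertible element v of R with a = a v a. -/
/-- Central orthogonality is stable under multiplying each element by arbitrary factors. -/
theorem CentOrth.mul_mul {R : Type*} [Ring R] {x y : R} (h : CentOrth x y) (c d c' d' : R) :
    CentOrth (c * x * d) (c' * y * d') := by
  intro r
  constructor
  · calc c * x * d * r * (c' * y * d') = c * (x * (d * r * c') * y) * d' := by noncomm_ring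
      _ = 0 := by rw [(h _).1]; simp
  · calc c' * y * d' * r * (c * x * d) = c' * (y * (d' * r * c) * x) * d := by noncomm_ring
      _ = 0 := by rw [(h _).2]; simp

/-- The two witnesses of quasi-invertibility can be merged into a single inner inverse. -/
theorem QuasiInv.exists_quasi_inverse {R : Type*} [Ring R] {u : R} (h : QuasiInv u) :
    ∃ v : R, u * v * u = u ∧ CentOrth (1 - u * v) (1 - v * u) := by
  obtain ⟨a, b, h⟩ := h
  refine ⟨a + b - a * u * b, ?_, ?_⟩
  · have h0 := (h u).1
    have key : u * (a + b - a * u * b) * u = u - (1 - u * a) * u * (1 - b * u) := by noncomm_ring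
    rw [key, h0, sub_zero]
  · have h1 := h.mul_mul 1 (1 - u * b) (1 - a * u) 1
    have e1 : 1 * (1 - u * a) * (1 - u * b) = 1 - u * (a + b - a * u * b) := by noncomm_ring
    have e2 : (1 - a * u) * (1 - b * u) * 1 = 1 - (a + b - a * u * b) * u := by noncomm_ring
    rwa [e1, e2] at h1

/-- Proposition 2.9: for a von Neumann regular element `a`, extending to a
quasi-invertible element is equivalent to having a quasi-invertible partial inverse. -/
theorem regular_extends_iff_quasiInv_partial_inverse
    {R : Type*} [Ring R] (a : R) (ha : VNRegular a) :
    (∃ u : R, QuasiInv u ∧ RegLe a u) ↔ (∃ v : R, QuasiInv v ∧ a = a * v * a) := by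
  constructor
  · rintro ⟨u, hu, x, hl, hr, hx⟩
    obtain ⟨v, huv, h⟩ := hu.exists_quasi_inverse
    refine ⟨v, ⟨u, u, fun r => (h r).symm⟩, ?_⟩
    symm
    calc a * v * a = (a * x * u) * v * (u * x * a) := by rw [← hl, ← hr]
      _ = a * x * (u * v * u) * x * a := by noncomm_ring
      _ = (a * x * u) * x * a := by rw [huv]
      _ = a := by rw [← hl, ← hx]
  · rintro ⟨v, hv, hava⟩
    obtain ⟨w, -, h⟩ := hv.exists_quasi_inverse
    refine ⟨a + (1 - a * v) * w * (1 - v * a), ⟨v, v, ?_⟩, v, ?_, ?_, hava⟩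
    · have h1 : CentOrth (1 - w * v) (1 - v * w) := fun r => (h r).symm
      have h2 := h1.mul_mul (1 - a * v) (1 - a * v) (1 - v * a) (1 - v * a)
      have e1 : (1 - a * v) * (1 - w * v) * (1 - a * v)
          = 1 - (a + (1 - a * v) * w * (1 - v * a)) * v - (a - a * v * a) * v := by noncomm_ring
      have e2 : (1 - v * a) * (1 - v * w) * (1 - v * a)
          = 1 - v * (a + (1 - a * v) * w * (1 - v * a)) - v * (a - a * v * a) := by noncomm_ring
      rwa [e1, e2, sub_eq_zero.mpr hava, zero_mul, mul_zero, sub_zero, sub_zero] at h2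
    · have key : a * v * (a + (1 - a * v) * w * (1 - v * a))
          = a * v * a + (a - a * v * a) * v * w * (1 - v * a) := by noncomm_ring
      rw [key, sub_eq_zero.mpr hava, ← hava]
      simp
    · have key : (a + (1 - a * v) * w * (1 - v * a)) * v * a
          = a * v * a + (1 - a * v) * w * v * (a - a * v * a) := by noncomm_ring
      rw [key, sub_eq_zero.mpr hava, ← hava]
      simp
end

section
/- Let R be a unital ring. Then cl({0}) equals the Jacobson radical of R; that is, an element a of R lies in the Jacobson radical if and only if for every x, b in R with x a + b = 1 there exists y in R with a + y b = 0. -/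
/-- `qcl A` is the set of `a` such that whenever `x a + b = 1`, some `a + y b` lies in `A`. -/
def qcl {R : Type*} [Ring R] (A : Set R) : Set R :=
  {a : R | ∀ x b : R, x * a + b = 1 → ∃ y : R, a + y * b ∈ A}

/-- Lemma 3.2 (v): `cl({0})` is the Jacobson radical of `R`:
`a` lies in the Jacobson radical iff whenever `x a + b = 1` there is `y` with `a + y b = 0`. -/
theorem qcl_zero_eq_jacobson {R : Type*} [Ring R] :
    qcl ({0} : Set R) = (Ideal.jacobson (⊥ : Ideal R) : Set R) := by
  ext a
  rw [SetLike.mem_coe, Ideal.mem_jacobson_iff]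
  simp only [qcl, Set.mem_ofPred_eq, Set.mem_singleton_iff, Ideal.mem_bot]
  constructor
  · intro h x
    obtain ⟨y, hy⟩ := h (-x) (1 + x * a) (by noncomm_ring)
    refine ⟨1 + x * y, ?_⟩
    calc (1 + x * y) * x * a + (1 + x * y) - 1 = x * (a + y * (1 + x * a)) := by noncomm_ring
      _ = 0 := by rw [hy, mul_zero]
  · intro h x b hb
    obtain ⟨z, hz⟩ := h (-x)
    obtain rfl : b = 1 - x * a := eq_sub_of_add_eq' hb
    refine ⟨-(a * z), ?_⟩
    calc a + -(a * z) * (1 - x * a) = -(a * (z * -x * a + z - 1)) := by noncomm_ring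
      _ = 0 := by rw [hz, mul_zero, neg_zero]
end

section
/- Let R be a unital ring. Then the following are equivalent: (i) for all a, x, b in R with x a + b = 1 there exists y in R with a + y b quasi-invertible; (ii) for all a, x, b in R with a x + b = 1 there exists y in R with a + b y quasi-invertible. (In other words, the defining condition of a QB-ring is left-right symmetric.) -/
/-- In a pair of mutually inverse `2 × 2` matrices `!![p, q; r, u]` and `!![w, s; t, z]`, the
entry `w` is quasi-invertible as soon as the complementary entry `u` is. -/
lemma QuasiInv.of_complementary {R : Type*} [Ring R] {u w p q r s t : R} (hu : QuasiInv u)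
    (hwp : w * p + s * r = 1) (hwq : w * q + s * u = 0)
    (hpw : p * w + q * t = 1) (hrw : r * w + u * t = 0) : QuasiInv w := by
  obtain ⟨c, d, h⟩ := hu
  have hl : 1 - w * (p - q * c * r) = s * (1 - u * c) * r := by
    linear_combination (norm := noncomm_ring) -hwp + hwq * (c * r)
  have hr : 1 - (p - q * d * r) * w = q * (1 - d * u) * t := by
    linear_combination (norm := noncomm_ring) -hpw + (q * d) * hrw
  refine ⟨p - q * c * r, p - q * d * r, fun m => ?_⟩
  rw [hl, hr]
  constructor
  · calc s * (1 - u * c) * r * m * (q * (1 - d * u) * t)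
        = s * ((1 - u * c) * (r * m * q) * (1 - d * u)) * t := by simp only [mul_assoc]
      _ = 0 := by rw [(h _).1, mul_zero, zero_mul]
  · calc q * (1 - d * u) * t * m * (s * (1 - u * c) * r)
        = q * ((1 - d * u) * (t * m * s) * (1 - u * c)) * r := by simp only [mul_assoc]
      _ = 0 := by rw [(h _).2, mul_zero, zero_mul]

lemma quasiInv_add_mul_one_sub_iff {R : Type*} [Ring R] (a x y : R) :
    QuasiInv (a + y * (1 - x * a)) ↔ QuasiInv (a + (1 - a * x) * y) := by
  constructor <;> intro h
  · refine h.of_complementary (p := x) (q := 1 - x * a) (r := y * x - 1) (s := -(1 - a * x))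
      (t := 1 - x * y) ?_ ?_ ?_ ?_ <;> noncomm_ring
  · refine h.of_complementary (p := x) (q := 1 - x * y) (r := -(1 - a * x)) (s := y * x - 1)
      (t := 1 - x * a) ?_ ?_ ?_ ?_ <;> noncomm_ring

/-- Theorem 3.6: the defining condition of a QB-ring is left-right symmetric. -/
theorem qb_left_right_symmetric {R : Type*} [Ring R] :
    (∀ a x b : R, x * a + b = 1 → ∃ y : R, QuasiInv (a + y * b)) ↔
    (∀ a x b : R, a * x + b = 1 → ∃ y : R, QuasiInv (a + b * y)) := by
  constructor
  · intro H a x b hb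
    obtain rfl : b = 1 - a * x := eq_sub_of_add_eq' hb
    obtain ⟨y, hy⟩ := H a x (1 - x * a) (add_sub_cancel _ _)
    exact ⟨y, (quasiInv_add_mul_one_sub_iff a x y).1 hy⟩
  · intro H a x b hb
    obtain rfl : b = 1 - x * a := eq_sub_of_add_eq' hb
    obtain ⟨y, hy⟩ := H a x (1 - a * x) (add_sub_cancel _ _)
    exact ⟨y, (quasiInv_add_mul_one_sub_iff a x y).2 hy⟩
end

section
/- Let R be a unital ring and I a two-sided ideal of R such that I + cl(R_q^{-1}) = R. Then the quotient ring R/I is a QB-ring. In particular, every quotient of a unital QB-ring by a two-sided ideal is a QB-ring. -/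
/-- `R` is a QB-ring: `cl(R_q⁻¹) = R`. -/
def IsQB (R : Type*) [Ring R] : Prop :=
  qcl {u : R | QuasiInv u} = Set.univ

theorem CentOrth.map {R S : Type*} [Ring R] [Ring S] {f : R →+* S}
    (hf : Function.Surjective f) {x y : R} (h : CentOrth x y) : CentOrth (f x) (f y) := by
  intro s
  obtain ⟨r, rfl⟩ := hf s
  simp only [← map_mul, (h r).1, (h r).2, map_zero, and_self]

theorem QuasiInv.map {R S : Type*} [Ring R] [Ring S] {f : R →+* S}
    (hf : Function.Surjective f) {u : R} (h : QuasiInv u) : QuasiInv (f u) := by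
  obtain ⟨a, b, hab⟩ := h
  exact ⟨f a, f b, by simpa using hab.map hf⟩

/-- Surjective homomorphisms preserve membership in `cl(R_q⁻¹)`. -/
theorem map_mem_qcl_quasiInv {R S : Type*} [Ring R] [Ring S] {f : R →+* S}
    (hf : Function.Surjective f) {t : R} (ht : t ∈ qcl {u : R | QuasiInv u}) :
    f t ∈ qcl {u : S | QuasiInv u} := by
  intro x b hxb
  obtain ⟨x, rfl⟩ := hf x
  obtain ⟨y, hy⟩ := ht x (1 - x * t) (by abel)
  obtain rfl : b = 1 - f x * f t := eq_sub_of_add_eq' hxb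
  exact ⟨f y, by simpa using QuasiInv.map hf hy⟩

/-- Corollary 3.8: if `I + cl(R_q⁻¹) = R` then `R/I` is a QB-ring; in particular
the QB-property passes to quotients. -/
theorem quotient_isQB {R : Type*} [Ring R] :
    (∀ I : TwoSidedIdeal R,
      (∀ r : R, ∃ i ∈ I, ∃ t ∈ qcl {u : R | QuasiInv u}, r = i + t) →
      IsQB I.ringCon.Quotient) ∧
    (IsQB R → ∀ I : TwoSidedIdeal R, IsQB I.ringCon.Quotient) := by
  have key : ∀ I : TwoSidedIdeal R,
      (∀ r : R, ∃ i ∈ I, ∃ t ∈ qcl {u : R | QuasiInv u}, r = i + t) →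
      IsQB I.ringCon.Quotient := by
    refine fun I h => Set.eq_univ_of_forall fun a => ?_
    obtain ⟨r, rfl⟩ := I.ringCon.mk'_surjective a
    obtain ⟨i, hi, t, ht, rfl⟩ := h r
    have hi0 : I.ringCon.mk' i = 0 := I.ringCon.eq.mpr hi
    rw [map_add, hi0, zero_add]
    exact map_mem_qcl_quasiInv I.ringCon.mk'_surjective ht
  refine ⟨key, fun hR I => key I fun r => ⟨0, I.zero_mem, r, ?_, (zero_add r).symm⟩⟩
  exact hR ▸ Set.mem_univ r
end

section
/- Let R be a unital ring and let a be a von Neumann regular element of R with a ∈ cl(R_q^{-1}). Then there exists a quasi-invertible element u of R with a ≤ u. In particular, in a unital QB-ring every von Neumann regular element extends to a quasi-invertible element. -/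
/-- Right multiplication by a unit preserves quasi-invertibility. -/
theorem QuasiInv.mul_unit {R : Type*} [Ring R] {u : R} (hu : QuasiInv u) (w : Rˣ) :
    QuasiInv (u * w) := by
  obtain ⟨a, b, h⟩ := hu
  have ha : 1 - u * w * (↑w⁻¹ * a) = 1 - u * a := by
    simp [mul_assoc]
  have hb : 1 - ↑w⁻¹ * b * (u * w) = ↑w⁻¹ * (1 - b * u) * w := by
    simp [mul_sub, sub_mul, mul_assoc]
  refine ⟨↑w⁻¹ * a, ↑w⁻¹ * b, fun r => ?_⟩
  rw [ha, hb]
  constructor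
  · calc (1 - u * a) * r * (↑w⁻¹ * (1 - b * u) * w)
        = (1 - u * a) * (r * ↑w⁻¹) * (1 - b * u) * w := by simp only [mul_assoc]
      _ = 0 := by rw [(h _).1, zero_mul]
  · calc ↑w⁻¹ * (1 - b * u) * w * r * (1 - u * a)
        = ↑w⁻¹ * ((1 - b * u) * (w * r) * (1 - u * a)) := by simp only [mul_assoc]
      _ = 0 := by rw [(h _).2, mul_zero]

/-- A von Neumann regular element has a generalized inverse that is reflexive. -/
theorem VNRegular.exists_reflexive_inverse {R : Type*} [Ring R] {a : R} (ha : VNRegular a) :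
    ∃ x : R, a * x * a = a ∧ x * a * x = x := by
  obtain ⟨x, hx⟩ := ha
  refine ⟨x * a * x, ?_, ?_⟩
  · calc a * (x * a * x) * a = a * x * a * x * a := by simp only [mul_assoc]
      _ = a := by rw [← hx, ← hx]
  · calc x * a * x * a * (x * a * x) = x * (a * x * a * x * a) * x := by simp only [mul_assoc]
      _ = x * a * x := by rw [← hx, ← hx]

/-- A von Neumann regular element of `cl(R_q⁻¹)` extends to a quasi-invertible element. -/
theorem VNRegular.exists_quasiInv_regLe {R : Type*} [Ring R] {a : R} (ha : VNRegular a)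
    (hcl : a ∈ qcl {u : R | QuasiInv u}) : ∃ u : R, QuasiInv u ∧ RegLe a u := by
  obtain ⟨x, hax, hxa⟩ := ha.exists_reflexive_inverse
  obtain ⟨y, hy⟩ := hcl x (1 - x * a) (add_sub_cancel _ _)
  have hpx : (1 - x * a) * x = 0 := by rw [sub_mul, one_mul, hxa, sub_self]
  have hpa : (1 - x * a) * (x * a) = 0 := by rw [← mul_assoc, hpx, zero_mul]
  have hxq : x * (1 - a * x) = 0 := by rw [mul_sub, mul_one, ← mul_assoc, hxa, sub_self]
  have hn : x * y * (1 - x * a) * (x * y * (1 - x * a)) = 0 := by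
    calc x * y * (1 - x * a) * (x * y * (1 - x * a))
        = x * y * ((1 - x * a) * x) * (y * (1 - x * a)) := by simp only [mul_assoc]
      _ = 0 := by rw [hpx, mul_zero, zero_mul]
  let w : Rˣ :=
    { val := 1 - x * y * (1 - x * a)
      inv := 1 + x * y * (1 - x * a)
      val_inv := by rw [sub_mul, one_mul, mul_one_add, hn]; abel
      inv_val := by rw [add_mul, one_mul, mul_one_sub (x * y * (1 - x * a)), hn]; abel }
  have hu : (a + y * (1 - x * a)) * w = a + (1 - a * x) * y * (1 - x * a) := by
    calc (a + y * (1 - x * a)) * (1 - x * y * (1 - x * a))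
        = a + (1 - a * x) * y * (1 - x * a)
            - y * ((1 - x * a) * x) * (y * (1 - x * a)) := by noncomm_ring
      _ = a + (1 - a * x) * y * (1 - x * a) := by rw [hpx, mul_zero, zero_mul, sub_zero]
  refine ⟨a + (1 - a * x) * y * (1 - x * a), hu ▸ QuasiInv.mul_unit hy w, x, ?_, ?_, hax.symm⟩
  · calc a = a * x * a + a * (x * (1 - a * x)) * (y * (1 - x * a)) := by
          rw [hxq, mul_zero, zero_mul, add_zero, hax]
      _ = a * x * (a + (1 - a * x) * y * (1 - x * a)) := by simp only [mul_add, mul_assoc]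
  · calc a = a * x * a + (1 - a * x) * y * ((1 - x * a) * (x * a)) := by
          rw [hpa, mul_zero, add_zero, hax]
      _ = (a + (1 - a * x) * y * (1 - x * a)) * x * a := by simp only [add_mul, mul_assoc]

/-- Theorem 5.9 and Corollary 5.10: a von Neumann regular element in `cl(R_q⁻¹)`
extends to a quasi-invertible element; in particular this holds for every
von Neumann regular element of a QB-ring. -/
theorem regular_in_qcl_extends {R : Type*} [Ring R] :
    (∀ a : R, VNRegular a → a ∈ qcl {u : R | QuasiInv u} →
      ∃ u : R, QuasiInv u ∧ RegLe a u) ∧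
    (IsQB R → ∀ a : R, VNRegular a → ∃ u : R, QuasiInv u ∧ RegLe a u) := by
  exact ⟨fun _ ha hcl => ha.exists_quasiInv_regLe hcl,
    fun hR _ ha => ha.exists_quasiInv_regLe (hR ▸ Set.mem_univ _)⟩
end

section
/- Let R be a unital ring, I a two-sided ideal of R, and π : R → R/I the quotient map. Then R is a QB-ring if and only if the following three conditions hold: (i) R/I is a QB-ring; (ii) π(R_q^{-1}) = (R/I)_q^{-1}, i.e. every quasi-invertible element of R/I lifts to a quasi-invertible element of R; (iii) I + R_q^{-1} ⊆ cl(R_q^{-1}), i.e. t + u ∈ cl(R_q^{-1}) for every t in I and every quasi-invertible u in R. -/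
namespace QuasiInv

variable {R S : Type*} [Ring R] [Ring S]

/-- A quasi-invertible element has a generalized inverse whose defects are centrally orthogonal. -/
theorem exists_generalized_inverse {u : R} (hu : QuasiInv u) :
    ∃ v : R, u * v * u = u ∧ v * u * v = v ∧ CentOrth (1 - u * v) (1 - v * u) := by
  obtain ⟨a, b, h⟩ := hu
  obtain ⟨v, hv⟩ : ∃ v, v = a + b - a * u * b := ⟨_, rfl⟩
  have huv : 1 - u * v = (1 - u * a) * (1 - u * b) := by rw [hv]; noncomm_ring
  have hvu : 1 - v * u = (1 - a * u) * (1 - b * u) := by rw [hv]; noncomm_ring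
  have huvu : u * v * u = u := by
    have h0 : u - u * v * u = (1 - u * a) * u * (1 - b * u) := by rw [hv]; noncomm_ring
    rw [(h u).1] at h0
    exact (sub_eq_zero.mp h0).symm
  have hor : CentOrth (1 - u * v) (1 - v * u) := by
    intro r
    rw [huv, hvu]
    constructor
    · have := (h ((1 - u * b) * r * (1 - a * u))).1
      simpa only [mul_assoc] using this
    · have := (h r).2
      calc (1 - a * u) * (1 - b * u) * r * ((1 - u * a) * (1 - u * b))
          = (1 - a * u) * ((1 - b * u) * r * (1 - u * a)) * (1 - u * b) := by
            simp only [mul_assoc]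
        _ = 0 := by rw [this, mul_zero, zero_mul]
  have hl : u * (v * u * v) = u * v := by rw [← mul_assoc, ← mul_assoc, huvu]
  have hr : v * u * v * u = v * u := by rw [mul_assoc (v * u), mul_assoc v u, ← mul_assoc u, huvu]
  refine ⟨v * u * v, by rw [hl, huvu], ?_, by rwa [hl, hr]⟩
  rw [hr, ← mul_assoc, ← mul_assoc, hr]

theorem map_s17 {u : R} (hu : QuasiInv u) {f : R →+* S} (hf : Function.Surjective f) :
    QuasiInv (f u) := by
  obtain ⟨a, b, h⟩ := hu
  refine ⟨f a, f b, fun r => ?_⟩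
  obtain ⟨r, rfl⟩ := hf r
  constructor
  · simpa using congrArg f (h r).1
  · simpa using congrArg f (h r).2

theorem mul_unit_s17 {u : R} (hu : QuasiInv u) (g : Rˣ) : QuasiInv (u * g) := by
  obtain ⟨a, b, h⟩ := hu
  have hl : 1 - u * g * (↑g⁻¹ * a) = 1 - u * a := by
    rw [mul_assoc u, Units.mul_inv_cancel_left]
  have hr : 1 - ↑g⁻¹ * b * (u * g) = ↑g⁻¹ * (1 - b * u) * g := by
    rw [mul_sub, sub_mul, mul_one, Units.inv_mul]
    simp only [mul_assoc]
  refine ⟨↑g⁻¹ * a, ↑g⁻¹ * b, fun r => ?_⟩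
  rw [hl, hr]
  constructor
  · have := (h (r * ↑g⁻¹)).1
    calc (1 - u * a) * r * (↑g⁻¹ * (1 - b * u) * g)
        = (1 - u * a) * (r * ↑g⁻¹) * (1 - b * u) * g := by simp only [mul_assoc]
      _ = 0 := by rw [this, zero_mul]
  · have := (h (g * r)).2
    calc ↑g⁻¹ * (1 - b * u) * g * r * (1 - u * a)
        = ↑g⁻¹ * ((1 - b * u) * (g * r) * (1 - u * a)) := by simp only [mul_assoc]
      _ = 0 := by rw [this, mul_zero]

end QuasiInv

namespace IsQB

variable {R S : Type*} [Ring R] [Ring S]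

theorem exists_quasiInv (hR : IsQB R) {x a b : R} (h : x * a + b = 1) :
    ∃ y : R, QuasiInv (a + y * b) :=
  (hR ▸ Set.mem_univ a : a ∈ qcl {u : R | QuasiInv u}) x b h

theorem of_surjective (hR : IsQB R) {f : R →+* S} (hf : Function.Surjective f) : IsQB S := by
  refine Set.eq_univ_of_forall fun a x b hxab => ?_
  obtain ⟨a, rfl⟩ := hf a
  obtain ⟨x, rfl⟩ := hf x
  obtain ⟨y, hy⟩ := hR.exists_quasiInv (add_sub_cancel (x * a) 1)
  refine ⟨f y, ?_⟩
  have hb : b = f (1 - x * a) := by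
    rw [map_sub, map_one, map_mul, ← hxab, add_sub_cancel_left]
  simpa [hb] using hy.map_s17 hf

/-- Quasi-invertible elements lift along surjections from a QB-ring. -/
theorem exists_quasiInv_lift (hR : IsQB R) {f : R →+* S} (hf : Function.Surjective f) {w : S}
    (hw : QuasiInv w) : ∃ u : R, QuasiInv u ∧ f u = w := by
  obtain ⟨v, hwvw, hvwv, hor⟩ := hw.exists_generalized_inverse
  obtain ⟨a, rfl⟩ := hf w
  obtain ⟨x, rfl⟩ := hf v
  obtain ⟨y, hu⟩ := hR.exists_quasiInv (add_sub_cancel (x * a) 1)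
  obtain ⟨c, hc⟩ : ∃ c, c = y * (1 - x * a) := ⟨_, rfl⟩
  rw [← hc] at hu
  -- The perturbation `f c` is absorbed by `f a * f x` on the left and killed by `f x`.
  have hfc : f c = f y * (1 - f x * f a) := by rw [hc]; simp
  have haxc : f a * f x * f c = f c := by
    have h0 := (hor (f y)).1
    rw [mul_assoc, ← hfc, sub_mul, one_mul] at h0
    exact (sub_eq_zero.mp h0).symm
  have hcx : f c * f x = 0 := by
    rw [hfc, mul_assoc, sub_mul, one_mul, hvwv, sub_self, mul_zero]
  obtain ⟨u, hudef⟩ : ∃ u, u = a + c := ⟨_, rfl⟩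
  rw [← hudef] at hu
  have hfu : f u = f a + f c := by rw [hudef, map_add]
  have hux : f u * f x = f a * f x := by rw [hfu, add_mul, hcx, add_zero]
  have huxu : f u * f x * f u = f u := by rw [hux, hfu, mul_add, hwvw, haxc]
  obtain ⟨s, hs, -, -⟩ := hu.exists_generalized_inverse
  have hfs : f u * f s * f u = f u := by rw [← map_mul, ← map_mul, hs]
  -- A generalized inverse `t` of `u` for which `f (t * u) = f (x * u)`.
  obtain ⟨t, ht⟩ : ∃ t, t = s + (1 - s * u) * x := ⟨_, rfl⟩
  have hut : u * t * u = u := by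
    calc u * t * u = u * s * u + (u - u * s * u) * x * u := by rw [ht]; noncomm_ring
      _ = u := by rw [hs]; simp
  have hftu : f t * f u = f x * f u := by
    calc f t * f u = f s * f u + f x * f u - f s * (f u * f x * f u) := by
          rw [ht]; simp only [map_add, map_mul, map_sub, map_one]; noncomm_ring
      _ = f x * f u := by rw [huxu]; abel
  obtain ⟨z, hz⟩ : ∃ z, z = t * u * (x * c) * (1 - t * u) := ⟨_, rfl⟩
  have hzz : z * z = 0 := by
    calc z * z = t * u * (x * c) * (t * u - t * (u * t * u)) * (x * c) * (1 - t * u) := by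
          rw [hz]; noncomm_ring
      _ = 0 := by rw [hut]; simp
  let g : Rˣ := ⟨1 - z, 1 + z,
    by rw [sub_mul, mul_add, mul_add, hzz]; simp, by rw [add_mul, mul_sub, mul_sub, hzz]; simp⟩
  refine ⟨u * g, hu.mul_unit_s17 g, ?_⟩
  have huz : u * z = u * x * c * (1 - t * u) := by
    calc u * z = u * t * u * (x * c) * (1 - t * u) := by rw [hz]; simp only [mul_assoc]
      _ = u * x * c * (1 - t * u) := by rw [hut]; simp only [mul_assoc]
  calc f (u * (1 - z)) = f u - f u * f x * f c * (1 - f t * f u) := by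
        rw [mul_sub, huz]; simp
    _ = f a + f c - (f c - f c * f x * f u) := by
        rw [hux, haxc, hftu, hfu]; noncomm_ring
    _ = f a := by rw [hcx]; simp

end IsQB

/-- Theorem 7.2: `R` is a QB-ring iff `R/I` is a QB-ring, quasi-invertibles lift
from `R/I`, and `I + R_q⁻¹ ⊆ cl(R_q⁻¹)`. -/
theorem qb_extension_characterization {R : Type*} [Ring R] (I : TwoSidedIdeal R) :
    IsQB R ↔
      (IsQB I.ringCon.Quotient ∧
       (RingCon.mk' I.ringCon) '' {u : R | QuasiInv u} =
         {w : I.ringCon.Quotient | QuasiInv w} ∧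
       (∀ t ∈ I, ∀ u : R, QuasiInv u → t + u ∈ qcl {w : R | QuasiInv w})) := by
  have hf : Function.Surjective (RingCon.mk' I.ringCon) := RingCon.mk'_surjective _
  constructor
  · intro hR
    refine ⟨hR.of_surjective hf, Set.Subset.antisymm ?_ ?_, fun t _ u _ => hR ▸ Set.mem_univ _⟩
    · rintro _ ⟨u, hu, rfl⟩
      exact QuasiInv.map_s17 hu hf
    · exact fun w hw => hR.exists_quasiInv_lift hf hw
  · rintro ⟨hS, hlift, hcl⟩
    refine Set.eq_univ_of_forall fun a x b hxab => ?_
    obtain ⟨y, hy⟩ := hS.exists_quasiInv (x := RingCon.mk' I.ringCon x)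
      (a := RingCon.mk' I.ringCon a) (b := RingCon.mk' I.ringCon b)
      (by rw [← map_mul, ← map_add, hxab, map_one])
    obtain ⟨y, rfl⟩ := hf y
    obtain ⟨u, hu, hua⟩ := hlift.ge hy
    have hmem : a + y * b - u ∈ I := by
      rw [← TwoSidedIdeal.rel_iff]
      refine (RingCon.eq _).mp ?_
      rw [← map_mul, ← map_add] at hua
      exact hua.symm
    obtain ⟨z, hz⟩ := hcl _ hmem u hu x ((1 - x * y) * b) (by
      rw [sub_add_cancel]; refine Eq.trans ?_ hxab; noncomm_ring)
    refine ⟨y + z * (1 - x * y), ?_⟩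
    rw [sub_add_cancel] at hz
    convert hz using 1
    noncomm_ring
end
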